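/- arXiv:1911.12444 — 3 statements merged into one kernel-verified Lean document; each statement's English description precedes it below -/
import Mathlib

section
/- For every nonempty v ⊆ {1,…,d} and every j ∈ v, the component g_v integrates to zero in its j-th coordinate: ∫_{Ω_j} g_v(x) dμ_j(x_j) = 0 for every value of the remaining coordinates x_{∼j}. -/
open MeasureTheory Finset
open scoped Classical

noncomputable section

variable {d N : ℕ}

/-- The indicator `1[a ≥ b]`. -/
def ind (a b : ℝ) : ℝ := if b ≤ a then 1 else 0

/-- The point of `ℝ^d` whose coordinates in `v` come from `x'` and whose remaining
coordinates come from `x`; i.e. `(x'_v, x_{∼v})`. -/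
def combine (v : Finset (Fin d)) (x' x : Fin d → ℝ) : Fin d → ℝ :=
  fun j => if j ∈ v then x' j else x j

/-- The weight kernel `∏_{j∈v} (F_j(x'_j) − 1[x'_j ≥ x_j]) / ρ_j(x'_j)`. -/
def wker (F ρ : Fin d → ℝ → ℝ) (v : Finset (Fin d)) (x' x : Fin d → ℝ) : ℝ :=
  ∏ j ∈ v, (F j (x' j) - ind (x' j) (x j)) / ρ j (x' j)

/-- The covariance kernel
`∏_{k∈v} (F_k(min(x_k,x'_k)) − F_k(x_k) F_k(x'_k)) / (ρ_k(x_k) ρ_k(x'_k))`. -/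
def covker (F ρ : Fin d → ℝ → ℝ) (v : Finset (Fin d)) (x x' : Fin d → ℝ) : ℝ :=
  ∏ k ∈ v, (F k (min (x k) (x' k)) - F k (x k) * F k (x' k)) / (ρ k (x k) * ρ k (x' k))

/-- The matrix variance `Var(h) = ∫ h hᵀ dπ − (∫ h dπ)(∫ h dπ)ᵀ`, entrywise. -/
def mVar (π : Measure (Fin d → ℝ)) (h : (Fin d → ℝ) → (Fin N → ℝ)) :
    Matrix (Fin N) (Fin N) ℝ :=
  Matrix.of fun i k => (∫ x, h x i * h x k ∂π) - (∫ x, h x i ∂π) * (∫ x, h x k ∂π)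

/-- `Df` is a coherent family of iterated cross-partial derivatives on `Ω`:
`Df (insert j v)` is the partial derivative of `Df v` in the `j`-th coordinate. -/
def CrossDerivChain (Ω : Fin d → Set ℝ)
    (Df : Finset (Fin d) → (Fin d → ℝ) → (Fin N → ℝ)) : Prop :=
  ∀ (v : Finset (Fin d)) (j : Fin d), j ∉ v → ∀ x : Fin d → ℝ, (∀ k, x k ∈ Ω k) →
    HasDerivAt (fun t => Df v (Function.update x j t)) (Df (insert j v) x) (x j)

/-- The derivative-based component
`g_v(x) = ∫_{Ω_v} (∂^{|v|}f/∂x_v)(x'_v, x_{∼v}) ∏_{j∈v} (F_j(x'_j) − 1[x'_j ≥ x_j])/ρ_j(x'_j) dμ(x'_v)`. -/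
def gcomp (μ : Fin d → Measure ℝ) (F ρ : Fin d → ℝ → ℝ)
    (Df : Finset (Fin d) → (Fin d → ℝ) → (Fin N → ℝ))
    (v : Finset (Fin d)) (x : Fin d → ℝ) : Fin N → ℝ :=
  ∫ x', wker F ρ v x' x • Df v (combine v x' x) ∂(Measure.pi μ)

end


noncomputable section

lemma integrable_ind (ν : Measure ℝ) [IsProbabilityMeasure ν] (s : ℝ) :
    Integrable (fun t => ind s t) ν := by
  have h : (fun t => ind s t) = (Set.Iic s).indicator 1 := by
    ext t; simp [ind, Set.indicator_apply]
  rw [h]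
  exact (integrable_const (1 : ℝ)).indicator measurableSet_Iic

lemma integral_ind (ν : Measure ℝ) (s : ℝ) :
    ∫ t, ind s t ∂ν = ν.real (Set.Iic s) := by
  have h : (fun t => ind s t) = (Set.Iic s).indicator 1 := by
    ext t; simp [ind, Set.indicator_apply]
  rw [h, integral_indicator_one measurableSet_Iic]

lemma abs_sub_ind {a : ℝ} (h0 : 0 ≤ a) (h1 : a ≤ 1) (s t : ℝ) :
    |a - ind s t| = a + (1 - 2 * a) * ind s t := by
  unfold ind
  split_ifs
  · rw [abs_of_nonpos (by linarith)]; ring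
  · rw [abs_of_nonneg (by linarith)]; ring

lemma measurable_ind_uncurry : Measurable fun p : ℝ × ℝ => ind p.1 p.2 :=
  Measurable.ite (measurableSet_le measurable_snd measurable_fst) measurable_const measurable_const

lemma measurable_measureReal_Iic (ν : Measure ℝ) [IsFiniteMeasure ν] :
    Measurable fun s => ν.real (Set.Iic s) :=
  Monotone.measurable fun _ _ h => measureReal_mono (Set.Iic_subset_Iic.2 h)

/-- No integrability is needed: if the inner integrand is integrable for a single `t`, Fubini
applies; otherwise the inner Bochner integral vanishes identically. -/
lemma integral_integral_cdf_sub_ind_smul {X E : Type*} [MeasurableSpace X]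
    [NormedAddCommGroup E] [NormedSpace ℝ E] [CompleteSpace E]
    (ν : Measure ℝ) [IsProbabilityMeasure ν] (π : Measure X) [SFinite π]
    {s : X → ℝ} (hs : Measurable s) {K : X → E} (hK : AEStronglyMeasurable K π) :
    ∫ t, ∫ x, (ν.real (Set.Iic (s x)) - ind (s x) t) • K x ∂π ∂ν = 0 := by
  by_cases hex : ∃ t₀, Integrable (fun x => (ν.real (Set.Iic (s x)) - ind (s x) t₀) • K x) π
  swap
  · push Not at hex
    simp [integral_undef (hex _)]
  obtain ⟨t₀, ht₀⟩ := hex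
  have hF0 (a : ℝ) : 0 ≤ ν.real (Set.Iic a) := measureReal_nonneg
  have hF1 (a : ℝ) : ν.real (Set.Iic a) ≤ 1 := measureReal_le_one
  have hker : Measurable fun p : ℝ × X => ν.real (Set.Iic (s p.2)) - ind (s p.2) p.1 :=
    ((measurable_measureReal_Iic ν).comp (hs.comp measurable_snd)).sub
      (measurable_ind_uncurry.comp ((hs.comp measurable_snd).prodMk measurable_fst))
  have hsec (x : X) : Integrable (fun t => ν.real (Set.Iic (s x)) - ind (s x) t) ν :=
    (integrable_const _).sub (integrable_ind ν _)
  have hmeas : AEStronglyMeasurable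
      (fun p : ℝ × X => (ν.real (Set.Iic (s p.2)) - ind (s p.2) p.1) • K p.2) (ν.prod π) :=
    hker.aestronglyMeasurable.smul hK.comp_snd
  have hint : Integrable
      (fun p : ℝ × X => (ν.real (Set.Iic (s p.2)) - ind (s p.2) p.1) • K p.2) (ν.prod π) := by
    rw [integrable_prod_iff' hmeas]
    refine ⟨.of_forall fun x => (hsec x).smul_const (K x), ?_⟩
    refine (ht₀.norm.const_mul 2).mono' hmeas.norm.prod_swap.integral_prod_right' ?_
    refine .of_forall fun x => ?_
    have hval : ∫ t, ‖(ν.real (Set.Iic (s x)) - ind (s x) t) • K x‖ ∂ν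
        = (2 * ν.real (Set.Iic (s x)) * (1 - ν.real (Set.Iic (s x)))) * ‖K x‖ := by
      simp_rw [norm_smul, Real.norm_eq_abs, abs_sub_ind (hF0 _) (hF1 _)]
      rw [integral_mul_const, integral_add (integrable_const _)
        ((integrable_ind ν _).const_mul _), integral_const_mul, integral_ind]
      simp only [integral_const, probReal_univ, one_smul]
      ring
    have h0 := hF0 (s x)
    have h1 := hF1 (s x)
    change ‖∫ t, ‖(ν.real (Set.Iic (s x)) - ind (s x) t) • K x‖ ∂ν‖ ≤ _
    rw [hval, Real.norm_of_nonneg (by have := sub_nonneg.2 h1; positivity), norm_smul,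
      Real.norm_eq_abs, abs_sub_ind h0 h1, ← mul_assoc]
    refine mul_le_mul_of_nonneg_right ?_ (norm_nonneg _)
    unfold ind
    split_ifs <;> nlinarith
  rw [integral_integral_swap hint]
  have hzero (x : X) : ∫ t, (ν.real (Set.Iic (s x)) - ind (s x) t) • K x ∂ν = 0 := by
    rw [integral_smul_const, integral_sub (integrable_const _) (integrable_ind ν _), integral_ind]
    simp
  simp [hzero]

lemma measurable_of_continuousOn_of_eq_zero {Ω : Set ℝ} (hΩ : IsOpen Ω) {ρ : ℝ → ℝ}
    (hc : ContinuousOn ρ Ω) (h0 : ∀ t ∉ Ω, ρ t = 0) : Measurable ρ := by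
  have h : ρ = Ω.piecewise ρ 0 := by
    ext t
    by_cases ht : t ∈ Ω <;> simp [ht, h0]
  rw [h]
  exact hc.measurable_piecewise continuousOn_const hΩ.measurableSet

lemma measurable_combine {d : ℕ} (v : Finset (Fin d)) (x : Fin d → ℝ) :
    Measurable fun x' => combine v x' x := by
  refine measurable_pi_lambda _ fun k => ?_
  unfold combine
  split_ifs
  · exact measurable_pi_apply k
  · exact measurable_const

lemma combine_update_of_mem {d : ℕ} {v : Finset (Fin d)} {j : Fin d} (hj : j ∈ v)
    (x' x : Fin d → ℝ) (t : ℝ) : combine v x' (Function.update x j t) = combine v x' x := by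
  ext k
  unfold combine
  split_ifs with hk
  · rfl
  · exact Function.update_of_ne (by rintro rfl; exact hk hj) _ _

lemma measurable_wker {d : ℕ} {F ρ : Fin d → ℝ → ℝ} (hF : ∀ j, Measurable (F j))
    (hρ : ∀ j, Measurable (ρ j)) (v : Finset (Fin d)) (x : Fin d → ℝ) :
    Measurable fun x' => wker F ρ v x' x := by
  refine Finset.measurable_fun_prod v fun k _ => ?_
  have hk : Measurable fun x' : Fin d → ℝ => x' k := measurable_pi_apply k
  exact (((hF k).comp hk).sub
    (measurable_ind_uncurry.comp (hk.prodMk measurable_const))).div ((hρ k).comp hk)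

lemma wker_update_of_mem {d : ℕ} (F ρ : Fin d → ℝ → ℝ) {v : Finset (Fin d)} {j : Fin d}
    (hj : j ∈ v) (x' x : Fin d → ℝ) (t : ℝ) :
    wker F ρ v x' (Function.update x j t) =
      (F j (x' j) - ind (x' j) t) * ((ρ j (x' j))⁻¹ * wker F ρ (v.erase j) x' x) := by
  unfold wker
  rw [← Finset.mul_prod_erase v _ hj, Function.update_self, div_eq_mul_inv, mul_assoc]
  congr 2
  refine Finset.prod_congr rfl fun k hk => ?_
  rw [Function.update_of_ne (Finset.ne_of_mem_erase hk)]

theorem components_centered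
    {d N : ℕ} (hd : 0 < d) (hN : 0 < N)
    (μ : Fin d → Measure ℝ) [∀ j, IsProbabilityMeasure (μ j)]
    (Ω : Fin d → Set ℝ) (hΩopen : ∀ j, IsOpen (Ω j))
    (ρ F : Fin d → ℝ → ℝ)
    (hdens : ∀ j, μ j = volume.withDensity fun t => ENNReal.ofReal (ρ j t))
    (hρcont : ∀ j, ContinuousOn (ρ j) (Ω j))
    (hρpos : ∀ j, ∀ t ∈ Ω j, 0 < ρ j t)
    (hρzero : ∀ j, ∀ t ∉ Ω j, ρ j t = 0)
    (hFdef : ∀ j t, F j t = ((μ j) (Set.Iic t)).toReal)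
    (f : (Fin d → ℝ) → (Fin N → ℝ))
    (Df : Finset (Fin d) → (Fin d → ℝ) → (Fin N → ℝ))
    (hDf0 : Df ∅ = f)
    (hchain : CrossDerivChain Ω Df)
    (hmeas : ∀ v, Measurable (Df v))
    (hsq : ∀ v, Integrable (fun x => ‖Df v x‖ ^ 2) (Measure.pi μ)) :
    ∀ v : Finset (Fin d), v.Nonempty → ∀ j ∈ v, ∀ x : Fin d → ℝ,
      (∫ t, gcomp μ F ρ Df v (Function.update x j t) ∂(μ j)) = (0 : Fin N → ℝ) := by
  intro v _ j hj x
  have hF (k : Fin d) : F k = fun t => (μ k).real (Set.Iic t) := funext (hFdef k)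
  have hFm (k : Fin d) : Measurable (F k) := hF k ▸ measurable_measureReal_Iic (μ k)
  have hρm (k : Fin d) : Measurable (ρ k) :=
    measurable_of_continuousOn_of_eq_zero (hΩopen k) (hρcont k) (hρzero k)
  have hK : Measurable fun x' =>
      ((ρ j (x' j))⁻¹ * wker F ρ (v.erase j) x' x) • Df v (combine v x' x) :=
    (((hρm j).comp (measurable_pi_apply j)).inv.mul (measurable_wker hFm hρm _ x)).smul
      ((hmeas v).comp (measurable_combine v x))
  have key := integral_integral_cdf_sub_ind_smul (μ j) (Measure.pi μ)
    (measurable_pi_apply j) hK.aestronglyMeasurable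
  simpa only [gcomp, wker_update_of_mem F ρ hj, combine_update_of_mem hj, mul_smul,
    hFdef j, measureReal_def] using key

end
end

section
/- Let u ⊆ {1,…,d} be nonempty and let h ∈ T^{u,d} satisfy (A6) together with the symmetry condition (A7): (∂^{|u|}h/∂x_u)(x'_u, x_{∼u}) · ∏_{j∈u} ρ_j(x_j) = (∂^{|u|}h/∂x_u)(x) · ∏_{j∈u} ρ_j(x'_j) for all x ∈ Ω and x'_u ∈ Ω_u. Then the variance of h is given exactly by the one-sample formula Var(h) = (1/2^{|u|}) ∫_Ω (∂^{|u|}h/∂x_u)(x) (∂^{|u|}h/∂x_u)(x)^T ∏_{k∈u} F_k(x_k)(1 − F_k(x_k))/ρ_k(x_k)² dμ(x). -/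
open MeasureTheory Finset
open scoped Classical

/-- `Dg` is a coherent family of iterated cross-partial derivatives on `Ω`,
along coordinates in `u` only. -/
def CrossDerivChainOn (Ω : Fin d → Set ℝ) (u : Finset (Fin d))
    (Dg : Finset (Fin d) → (Fin d → ℝ) → (Fin N → ℝ)) : Prop :=
  ∀ v ⊆ u, ∀ j ∈ u, j ∉ v → ∀ x : Fin d → ℝ, (∀ k, x k ∈ Ω k) →
    HasDerivAt (fun t => Dg v (Function.update x j t)) (Dg (insert j v) x) (x j)

noncomputable section

theorem ProbabilityTheory.continuous_cdf (μ : Measure ℝ) [IsProbabilityMeasure μ] [NullSingletonClass μ] :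
    Continuous (cdf μ) := by
  refine continuous_iff_continuousAt.2 fun x => ?_
  rw [(monotone_cdf μ).continuousAt_iff_leftLim_eq_rightLim, StieltjesFunction.rightLim_eq]
  have h := (cdf μ).measure_singleton x
  rw [measure_cdf, measure_singleton, eq_comm, ENNReal.ofReal_eq_zero] at h
  exact le_antisymm ((monotone_cdf μ).leftLim_le le_rfl) (by linarith)

/-- Probability integral transform. -/
theorem ProbabilityTheory.map_cdf_eq_restrict (μ : Measure ℝ) [IsProbabilityMeasure μ]
    [NullSingletonClass μ] : μ.map (cdf μ) = volume.restrict (Set.Icc 0 1) := by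
  have hmeas : Measurable (cdf μ) := (monotone_cdf μ).measurable
  have := Measure.isProbabilityMeasure_map (μ := μ) hmeas.aemeasurable
  have hquantile : ∀ y ∈ Set.Ioo (0 : ℝ) 1, ∃ t, cdf μ t = y := fun y hy =>
    mem_range_of_exists_le_of_exists_ge (continuous_cdf μ)
      (((tendsto_cdf_atBot μ).eventually (gt_mem_nhds hy.1)).exists.imp fun _ h => h.le)
      (((tendsto_cdf_atTop μ).eventually (lt_mem_nhds hy.2)).exists.imp fun _ h => h.le)
  have hle : ∀ y ∈ Set.Ioo (0 : ℝ) 1, ENNReal.ofReal y ≤ μ.map (cdf μ) (Set.Iic y) := by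
    intro y hy
    obtain ⟨t, rfl⟩ := hquantile y hy
    rw [Measure.map_apply hmeas measurableSet_Iic, ofReal_cdf]
    exact measure_mono fun s hs => monotone_cdf μ hs
  have hge : ∀ y ∈ Set.Ioo (0 : ℝ) 1, μ.map (cdf μ) (Set.Iio y) ≤ ENNReal.ofReal y := by
    intro y hy
    obtain ⟨t, rfl⟩ := hquantile y hy
    rw [Measure.map_apply hmeas measurableSet_Iio, ofReal_cdf]
    exact measure_mono fun s hs => ((monotone_cdf μ).reflect_lt hs).le
  have hge' : ∀ y ∈ Set.Ico (0 : ℝ) 1, μ.map (cdf μ) (Set.Iic y) ≤ ENNReal.ofReal y := by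
    intro y hy
    refine ge_of_tendsto (x := nhdsWithin y (Set.Ioi y)) (f := ENNReal.ofReal)
      (ENNReal.continuous_ofReal.continuousAt.tendsto.mono_left nhdsWithin_le_nhds) ?_
    filter_upwards [Ioo_mem_nhdsGT hy.2] with z hz
    exact (measure_mono (Set.Iic_subset_Iio.2 hz.1)).trans (hge z ⟨hy.1.trans_lt hz.1, hz.2⟩)
  refine Measure.ext_of_Iic _ _ fun y => ?_
  rw [Measure.restrict_apply measurableSet_Iic]
  rcases lt_or_ge y 0 with hy0 | hy0
  · rw [show Set.Iic y ∩ Set.Icc 0 1 = ∅ by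
      ext z; simp only [Set.mem_inter_iff, Set.mem_Iic, Set.mem_Icc, Set.mem_empty_iff_false]
      constructor
      · intro h; linarith [h.1, h.2.1]
      · exact False.elim, measure_empty]
    refine le_antisymm ((measure_mono (Set.Iic_subset_Iic.2 hy0.le)).trans ?_) zero_le
    simpa using hge' 0 ⟨le_rfl, one_pos⟩
  rcases lt_or_ge y 1 with hy1 | hy1
  · rw [show Set.Iic y ∩ Set.Icc 0 1 = Set.Icc 0 y by
      ext z; simp only [Set.mem_inter_iff, Set.mem_Iic, Set.mem_Icc]
      constructor
      · exact fun h => ⟨h.2.1, h.1⟩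
      · exact fun h => ⟨h.2, h.1, h.2.trans hy1.le⟩, Real.volume_Icc, sub_zero]
    refine le_antisymm (hge' y ⟨hy0, hy1⟩) ?_
    rcases hy0.eq_or_lt with rfl | hy0
    · simp
    · exact hle y ⟨hy0, hy1⟩
  · rw [Set.inter_eq_right.2 fun z hz => hz.2.trans hy1, Real.volume_Icc, sub_zero,
      ENNReal.ofReal_one, Measure.map_apply hmeas measurableSet_Iic,
      Set.eq_univ_of_forall (s := cdf μ ⁻¹' Set.Iic y) fun t => (cdf_le_one μ t).trans hy1,
      measure_univ]

theorem ProbabilityTheory.integral_comp_cdf (μ : Measure ℝ) [IsProbabilityMeasure μ]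
    [NullSingletonClass μ] {g : ℝ → ℝ} (hg : Continuous g) :
    ∫ t, g (cdf μ t) ∂μ = ∫ y in (0 : ℝ)..1, g y := by
  rw [← integral_map (φ := cdf μ) (f := g) (monotone_cdf μ).measurable.aemeasurable
    hg.aestronglyMeasurable, map_cdf_eq_restrict, intervalIntegral.integral_of_le zero_le_one,
    integral_Icc_eq_integral_Ioc]

theorem integral_pi_finset_prod {d : ℕ} (μ : Fin d → Measure ℝ)
    [∀ j, IsProbabilityMeasure (μ j)] (u : Finset (Fin d)) (φ : Fin d → ℝ → ℝ) :
    ∫ x, ∏ j ∈ u, φ j (x j) ∂(Measure.pi μ) = ∏ j ∈ u, ∫ t, φ j t ∂(μ j) := by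
  have h := integral_fintype_prod_eq_prod (μ := μ) (𝕜 := ℝ)
    (fun j t => if j ∈ u then φ j t else 1)
  have e : ∀ j, (∫ t, (if j ∈ u then φ j t else 1) ∂(μ j))
      = if j ∈ u then ∫ t, φ j t ∂(μ j) else 1 := by
    intro j; split_ifs <;> simp
  simpa only [e, Finset.prod_ite_mem, Finset.univ_inter] using h

theorem measurable_of_continuousOn_of_eq_zero_s10 {s : Set ℝ} (hs : IsOpen s) {g : ℝ → ℝ}
    (hg : ContinuousOn g s) (h0 : ∀ t ∉ s, g t = 0) : Measurable g := by
  have heq : g = s.piecewise g fun _ => 0 := by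
    ext t
    by_cases ht : t ∈ s
    · simp [ht]
    · simp [ht, h0 t ht]
  rw [heq]
  exact hg.measurable_piecewise continuousOn_const hs.measurableSet

theorem measurable_combine_s10 {d : ℕ} (u : Finset (Fin d)) (x₀ : Fin d → ℝ) :
    Measurable (combine u x₀) := by
  refine measurable_pi_lambda _ fun j => ?_
  by_cases hj : j ∈ u
  · simp [combine, hj]
  · simpa [combine, hj] using measurable_pi_apply j

/-- Under a product measure, a product of functions of the coordinates in `u` is independent of
any function of the remaining coordinates. -/
theorem indepFun_prod_comp_combine {d : ℕ} (μ : Fin d → Measure ℝ)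
    [∀ j, IsProbabilityMeasure (μ j)] (u : Finset (Fin d)) {φ : Fin d → ℝ → ℝ}
    (hφ : ∀ j, Measurable (φ j)) (x₀ : Fin d → ℝ) {c : (Fin d → ℝ) → ℝ} (hc : Measurable c) :
    ProbabilityTheory.IndepFun (fun x => ∏ j ∈ u, φ j (x j)) (fun x => c (combine u x₀ x))
      (Measure.pi μ) := by
  have hindep : ProbabilityTheory.iIndepFun (fun j (x : Fin d → ℝ) => x j) (Measure.pi μ) :=
    ProbabilityTheory.iIndepFun_pi (X := fun _ => id) fun _ => aemeasurable_id
  have hsplit := hindep.indepFun_finset u uᶜ disjoint_compl_right measurable_pi_apply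
  have hleft : Measurable fun y : u → ℝ => ∏ j : u, φ j (y j) :=
    Finset.measurable_fun_prod _ fun j _ => (hφ j).comp (measurable_pi_apply j)
  have hright : Measurable fun y : (uᶜ : Finset (Fin d)) → ℝ =>
      c fun j => if hj : j ∈ u then x₀ j else y ⟨j, Finset.mem_compl.2 hj⟩ := by
    refine hc.comp (measurable_pi_lambda _ fun j => ?_)
    by_cases hj : j ∈ u
    · simp [hj]
    · simpa [hj] using measurable_pi_apply _
  convert hsplit.comp hleft hright using 1
  · ext x
    exact (Finset.prod_coe_sort u fun j => φ j (x j)).symm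
  · ext x
    simp [funext fun j => show combine u x₀ x j = if j ∈ u then x₀ j else x j from rfl]

theorem integral_prod_mul_comp_combine {d : ℕ} (μ : Fin d → Measure ℝ)
    [∀ j, IsProbabilityMeasure (μ j)] (u : Finset (Fin d)) {φ : Fin d → ℝ → ℝ}
    (hφ : ∀ j, Measurable (φ j)) (x₀ : Fin d → ℝ) {c : (Fin d → ℝ) → ℝ} (hc : Measurable c) :
    ∫ x, (∏ j ∈ u, φ j (x j)) * c (combine u x₀ x) ∂(Measure.pi μ)
      = (∏ j ∈ u, ∫ t, φ j t ∂(μ j)) * ∫ x, c (combine u x₀ x) ∂(Measure.pi μ) := by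
  rw [(indepFun_prod_comp_combine μ u hφ x₀ hc).integral_fun_mul_eq_mul_integral
    (Finset.measurable_fun_prod _ fun j _ =>
      (hφ j).comp (measurable_pi_apply j)).aestronglyMeasurable
    (hc.comp (measurable_combine_s10 u x₀)).aestronglyMeasurable, integral_pi_finset_prod]

theorem integral_cdf_sub_half (μ : Measure ℝ) [IsProbabilityMeasure μ] [NullSingletonClass μ] :
    ∫ t, (ProbabilityTheory.cdf μ t - 1 / 2) ∂μ = 0 := by
  rw [ProbabilityTheory.integral_comp_cdf μ (g := fun y => y - 1 / 2) (by fun_prop),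
    intervalIntegral.integral_sub (by simp) (by simp)]
  norm_num

theorem integral_cdf_mul_one_sub (μ : Measure ℝ) [IsProbabilityMeasure μ]
    [NullSingletonClass μ] :
    ∫ t, ProbabilityTheory.cdf μ t * (1 - ProbabilityTheory.cdf μ t) ∂μ = 1 / 6 := by
  rw [ProbabilityTheory.integral_comp_cdf μ (g := fun y => y * (1 - y)) (by fun_prop)]
  simp_rw [show ∀ y : ℝ, y * (1 - y) = y - y ^ 2 by intro y; ring]
  rw [intervalIntegral.integral_sub (by simp) (by simp)]
  norm_num

theorem integral_sq_cdf_sub_half (μ : Measure ℝ) [IsProbabilityMeasure μ]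
    [NullSingletonClass μ] :
    ∫ t, (ProbabilityTheory.cdf μ t - 1 / 2) ^ 2 ∂μ = 1 / 12 := by
  rw [ProbabilityTheory.integral_comp_cdf μ (g := fun y => (y - 1 / 2) ^ 2) (by fun_prop)]
  rw [intervalIntegral.integral_comp_sub_right (fun y => y ^ 2)]
  norm_num

theorem integrable_cdf (μ : Measure ℝ) [IsProbabilityMeasure μ] :
    Integrable (ProbabilityTheory.cdf μ) μ :=
  Integrable.of_bound (ProbabilityTheory.monotone_cdf μ).measurable.aestronglyMeasurable 1
    (Filter.Eventually.of_forall fun t => by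
      rw [Real.norm_of_nonneg (ProbabilityTheory.cdf_nonneg μ t)]
      exact ProbabilityTheory.cdf_le_one μ t)

theorem integral_cdf_sub_ind (μ : Measure ℝ) [IsProbabilityMeasure μ] [NullSingletonClass μ]
    (s : ℝ) :
    ∫ t, (ProbabilityTheory.cdf μ t - ind t s) ∂μ = ProbabilityTheory.cdf μ s - 1 / 2 := by
  have hind : (fun t => ind t s) = (Set.Ici s).indicator fun _ => (1 : ℝ) := by
    ext t; simp [ind, Set.indicator_apply]
  have hmean : ∫ t, ProbabilityTheory.cdf μ t ∂μ = 1 / 2 := by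
    have h := integral_cdf_sub_half μ
    rw [integral_sub (integrable_cdf μ) (integrable_const _)] at h
    simp at h
    linarith
  have hIci : μ.real (Set.Ici s) = 1 - ProbabilityTheory.cdf μ s := by
    rw [← Set.compl_Iio, probReal_compl_eq_one_sub measurableSet_Iio,
      ProbabilityTheory.cdf_eq_real, measureReal_congr Iio_ae_eq_Iic]
  rw [integral_sub (integrable_cdf μ), hmean, hind, integral_indicator_const _ measurableSet_Ici,
    hIci, smul_eq_mul]
  · ring
  · rw [hind]
    exact (integrable_const _).indicator measurableSet_Ici

/-- A component of the form `f`-derivative times weight kernel is explicit when the derivative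
factors as the density of the coordinates in `u` times a function of the other coordinates. -/
theorem integral_wker_smul_eq {d N : ℕ} (μ : Fin d → Measure ℝ)
    [∀ j, IsProbabilityMeasure (μ j)] [∀ j, NullSingletonClass (μ j)] (Ω : Fin d → Set ℝ)
    {ρ : Fin d → ℝ → ℝ} (hρpos : ∀ j, ∀ t ∈ Ω j, 0 < ρ j t)
    (hΩ : ∀ᵐ x ∂(Measure.pi μ), ∀ j, x j ∈ Ω j) (u : Finset (Fin d))
    (G : (Fin d → ℝ) → Fin N → ℝ) (x₀ : Fin d → ℝ) (c : (Fin d → ℝ) → Fin N → ℝ)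
    (hG : ∀ x : Fin d → ℝ, (∀ j, x j ∈ Ω j) →
      G x = (∏ j ∈ u, ρ j (x j)) • c (combine u x₀ x))
    (x : Fin d → ℝ) (hx : ∀ j, x j ∈ Ω j) :
    ∫ x', wker (fun j => ProbabilityTheory.cdf (μ j)) ρ u x' x • G (combine u x' x)
        ∂(Measure.pi μ)
      = (∏ j ∈ u, (ProbabilityTheory.cdf (μ j) (x j) - 1 / 2)) • c (combine u x₀ x) := by
  have hae : ∀ᵐ x' ∂(Measure.pi μ),
      wker (fun j => ProbabilityTheory.cdf (μ j)) ρ u x' x • G (combine u x' x)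
        = (∏ j ∈ u, (ProbabilityTheory.cdf (μ j) (x' j) - ind (x' j) (x j)))
          • c (combine u x₀ x) := by
    filter_upwards [hΩ] with x' hx'
    have hmem : ∀ j, combine u x' x j ∈ Ω j := fun j => by
      by_cases hj : j ∈ u
      · simpa [combine, hj] using hx' j
      · simpa [combine, hj] using hx j
    have hcomb : combine u x₀ (combine u x' x) = combine u x₀ x := by
      ext j; by_cases hj : j ∈ u <;> simp [combine, hj]
    rw [hG _ hmem, hcomb, smul_smul, wker, ← Finset.prod_mul_distrib]
    congr 1
    refine Finset.prod_congr rfl fun j hj => ?_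
    simp only [combine, hj, if_true]
    exact div_mul_cancel₀ _ (hρpos j _ (hx' j)).ne'
  rw [integral_congr_ae hae, integral_smul_const, integral_pi_finset_prod μ u
    fun j t => ProbabilityTheory.cdf (μ j) t - ind t (x j)]
  simp_rw [integral_cdf_sub_ind]

theorem one_sample_variance_formula
    {d N : ℕ} (hd : 0 < d) (hN : 0 < N)
    (μ : Fin d → Measure ℝ) [∀ j, IsProbabilityMeasure (μ j)]
    (Ω : Fin d → Set ℝ) (hΩopen : ∀ j, IsOpen (Ω j))
    (ρ F : Fin d → ℝ → ℝ)
    (hdens : ∀ j, μ j = volume.withDensity fun t => ENNReal.ofReal (ρ j t))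
    (hρcont : ∀ j, ContinuousOn (ρ j) (Ω j))
    (hρpos : ∀ j, ∀ t ∈ Ω j, 0 < ρ j t)
    (hρzero : ∀ j, ∀ t ∉ Ω j, ρ j t = 0)
    (hFdef : ∀ j t, F j t = ((μ j) (Set.Iic t)).toReal)
    (f : (Fin d → ℝ) → (Fin N → ℝ))
    (Df : Finset (Fin d) → (Fin d → ℝ) → (Fin N → ℝ))
    (hDf0 : Df ∅ = f)
    (hchain : CrossDerivChain Ω Df)
    (hmeas : ∀ v, Measurable (Df v))
    (hsq : ∀ v, Integrable (fun x => ‖Df v x‖ ^ 2) (Measure.pi μ))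
    (u : Finset (Fin d)) (hu : u.Nonempty) (ε : ℝ) (hε : ε = 1 ∨ ε = -1)
    (α : Fin N → ℝ) (h : (Fin d → ℝ) → (Fin N → ℝ))
    (hhdef : ∀ x, h x =
      ε • (∫ x', wker F ρ u x' x • Df u (combine u x' x) ∂(Measure.pi μ)) + α)
    (Dh : Finset (Fin d) → (Fin d → ℝ) → (Fin N → ℝ))
    (hDh0 : Dh ∅ = h) (hDhchain : CrossDerivChainOn Ω u Dh)
    (hA6 : Dh u = Df u)
    (hA7 : ∀ x : Fin d → ℝ, (∀ j, x j ∈ Ω j) → ∀ x' : Fin d → ℝ, (∀ j ∈ u, x' j ∈ Ω j) →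
      (∏ j ∈ u, ρ j (x j)) • Dh u (combine u x' x)
        = (∏ j ∈ u, ρ j (x' j)) • Dh u x) :
    mVar (Measure.pi μ) h =
      ((1 : ℝ) / 2 ^ u.card) • Matrix.of fun i k =>
        ∫ x, Dh u x i * Dh u x k *
          ∏ j ∈ u, (F j (x j) * (1 - F j (x j)) / (ρ j (x j)) ^ 2) ∂(Measure.pi μ) := by
  obtain rfl : F = fun j => ⇑(ProbabilityTheory.cdf (μ j)) := by
    funext j t
    rw [hFdef, ProbabilityTheory.cdf_eq_real, measureReal_def]
  have hnull : ∀ j, NullSingletonClass (μ j) := fun j => by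
    rw [hdens j]; infer_instance
  have hρmeas : ∀ j, Measurable (ρ j) := fun j =>
    measurable_of_continuousOn_of_eq_zero_s10 (hΩopen j) (hρcont j) (hρzero j)
  have hΩj : ∀ j, ∀ᵐ t ∂(μ j), t ∈ Ω j := fun j => by
    have hcompl : μ j (Ω j)ᶜ = 0 := by
      rw [hdens j, withDensity_apply _ (hΩopen j).measurableSet.compl,
        setLIntegral_congr_fun (g := fun _ => 0) (hΩopen j).measurableSet.compl
          fun t ht => by simp [hρzero j t ht]]
      simp
    exact hcompl
  have hΩae : ∀ᵐ x ∂(Measure.pi μ), ∀ j, x j ∈ Ω j :=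
    ae_all_iff.2 fun j => (Measure.quasiMeasurePreserving_eval μ j).ae (hΩj j)
  choose x₀ hx₀ using fun j => (hΩj j).exists
  have hρ₀ : ∏ j ∈ u, ρ j (x₀ j) ≠ 0 := Finset.prod_ne_zero_iff.2 fun j _ =>
    (hρpos j _ (hx₀ j)).ne'
  set c : (Fin d → ℝ) → Fin N → ℝ := fun x => (∏ j ∈ u, ρ j (x₀ j))⁻¹ • Dh u x with hc
  have hcmeas : ∀ i, Measurable fun x => c x i := fun i => by
    rw [hc, hA6]
    exact ((measurable_pi_apply i).comp (hmeas u)).const_smul _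
  have hccmeas : ∀ i k, Measurable fun x => c x i * c x k := fun i k =>
    (hcmeas i).mul (hcmeas k)
  have hG : ∀ x : Fin d → ℝ, (∀ j, x j ∈ Ω j) →
      Dh u x = (∏ j ∈ u, ρ j (x j)) • c (combine u x₀ x) := fun x hx => by
    rw [hc]
    simp only
    rw [smul_comm, hA7 x hx x₀ fun j _ => hx₀ j, smul_smul, inv_mul_cancel₀ hρ₀, one_smul]
  have hcsq : ∀ i, Integrable (fun x => c (combine u x₀ x) i ^ 2) (Measure.pi μ) := fun i => by
    have hprodmeas : Measurable fun x : Fin d → ℝ => ∏ j ∈ u, ρ j (x j) ^ 2 :=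
      Finset.measurable_fun_prod _ fun j _ => ((hρmeas j).pow_const 2).comp (measurable_pi_apply j)
    refine (indepFun_prod_comp_combine μ u (fun j => (hρmeas j).pow_const 2) x₀
      ((hcmeas i).pow_const 2)).integrable_right_of_integrable_op (fun a b => a * b) 1 one_ne_zero
      (fun a b => by simp [enorm_mul]) ?_ hprodmeas.aestronglyMeasurable
      (((hcmeas i).pow_const 2).comp (measurable_combine_s10 u x₀)).aestronglyMeasurable ?_
    · refine (hsq u).mono' (hprodmeas.mul
        (((hcmeas i).pow_const 2).comp (measurable_combine_s10 u x₀))).aestronglyMeasurable ?_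
      filter_upwards [hΩae] with x hx
      have hle : |Dh u x i| ≤ ‖Dh u x‖ := norm_le_pi_norm (Dh u x) i
      have heq : (∏ j ∈ u, ρ j (x j) ^ 2) * c (combine u x₀ x) i ^ 2 = |Dh u x i| ^ 2 := by
        rw [sq_abs, hG x hx, Pi.smul_apply, smul_eq_mul, mul_pow, Finset.prod_pow]
      rw [← hA6, heq, Real.norm_of_nonneg (by positivity)]
      gcongr
    · intro hzero
      obtain ⟨x, hx, hx0⟩ := (hΩae.and hzero).exists
      exact Finset.prod_ne_zero_iff.2 (fun j _ => pow_ne_zero 2 (hρpos j _ (hx j)).ne') hx0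
  have hcL2 : ∀ i, MemLp (fun x => c (combine u x₀ x) i) 2 (Measure.pi μ) := fun i =>
    (memLp_two_iff_integrable_sq
      ((hcmeas i).comp (measurable_combine_s10 u x₀)).aestronglyMeasurable).2 (hcsq i)
  have hcdf : ∀ j, Measurable fun t => ProbabilityTheory.cdf (μ j) t - 1 / 2 := fun j =>
    (ProbabilityTheory.monotone_cdf (μ j)).measurable.sub_const _
  set P : (Fin d → ℝ) → ℝ := fun x =>
    ∏ j ∈ u, (ProbabilityTheory.cdf (μ j) (x j) - 1 / 2) with hP
  have hPmeas : Measurable P :=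
    Finset.measurable_fun_prod _ fun j _ => (hcdf j).comp (measurable_pi_apply j)
  have hPbound : ∀ x, ‖P x‖ ≤ 1 := fun x => by
    rw [hP, norm_prod]
    refine Finset.prod_le_one (fun _ _ => norm_nonneg _) fun j _ => ?_
    have h0 := ProbabilityTheory.cdf_nonneg (μ j) (x j)
    have h1 := ProbabilityTheory.cdf_le_one (μ j) (x j)
    rw [Real.norm_eq_abs, abs_le]
    constructor <;> linarith
  have hhae : ∀ᵐ x ∂(Measure.pi μ), ∀ i, h x i = ε * (P x * c (combine u x₀ x) i) + α i := by
    filter_upwards [hΩae] with x hx i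
    rw [hhdef x, ← hA6, integral_wker_smul_eq μ Ω hρpos hΩae u (Dh u) x₀ c hG x hx]
    simp [hP]
  have hint1 : ∀ i, Integrable (fun x => P x * c (combine u x₀ x) i) (Measure.pi μ) := fun i =>
    ((hcL2 i).integrable one_le_two).bdd_mul hPmeas.aestronglyMeasurable
      (Filter.Eventually.of_forall hPbound)
  have hint2 : ∀ i k, Integrable (fun x => P x ^ 2 * (c (combine u x₀ x) i * c (combine u x₀ x) k))
      (Measure.pi μ) := fun i k =>
    ((hcL2 i).integrable_mul (hcL2 k)).bdd_mul (hPmeas.pow_const 2).aestronglyMeasurable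
      (Filter.Eventually.of_forall fun x => by
        rw [norm_pow]; exact pow_le_one₀ (norm_nonneg _) (hPbound x))
  have hmean1 : ∀ i, ∫ x, P x * c (combine u x₀ x) i ∂(Measure.pi μ) = 0 := fun i => by
    rw [hP, integral_prod_mul_comp_combine μ u hcdf x₀ (hcmeas i)]
    simp_rw [integral_cdf_sub_half]
    simp [hu.card_ne_zero]
  have hmean2 : ∀ i k, ∫ x, P x ^ 2 * (c (combine u x₀ x) i * c (combine u x₀ x) k) ∂(Measure.pi μ)
      = (1 / 12) ^ u.card * ∫ x, c (combine u x₀ x) i * c (combine u x₀ x) k ∂(Measure.pi μ) :=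
    fun i k => by
      simp_rw [hP, ← Finset.prod_pow]
      rw [integral_prod_mul_comp_combine μ u (fun j => (hcdf j).pow_const 2) x₀
        (hccmeas i k)]
      simp_rw [integral_sq_cdf_sub_half]
      simp
  have hE : ∀ i, ∫ x, h x i ∂(Measure.pi μ) = α i := fun i => by
    rw [integral_congr_ae (hhae.mono fun x hx => hx i),
      integral_add ((hint1 i).const_mul ε) (integrable_const _), integral_const_mul, hmean1]
    simp
  have hε2 : ε ^ 2 = 1 := by rcases hε with rfl | rfl <;> norm_num
  have hEE : ∀ i k, ∫ x, h x i * h x k ∂(Measure.pi μ)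
      = (1 / 12) ^ u.card * (∫ x, c (combine u x₀ x) i * c (combine u x₀ x) k ∂(Measure.pi μ))
        + α i * α k := fun i k => by
    have hexp : ∀ᵐ x ∂(Measure.pi μ), h x i * h x k
        = P x ^ 2 * (c (combine u x₀ x) i * c (combine u x₀ x) k)
          + (ε * α k) * (P x * c (combine u x₀ x) i)
          + (ε * α i) * (P x * c (combine u x₀ x) k) + α i * α k := by
      filter_upwards [hhae] with x hx
      rw [hx i, hx k]
      linear_combination (P x ^ 2 * (c (combine u x₀ x) i * c (combine u x₀ x) k)) * hε2
    have hadd : Integrable (fun x => P x ^ 2 * (c (combine u x₀ x) i * c (combine u x₀ x) k)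
        + (ε * α k) * (P x * c (combine u x₀ x) i)) (Measure.pi μ) :=
      (hint2 i k).add ((hint1 i).const_mul _)
    have hadd' : Integrable (fun x => P x ^ 2 * (c (combine u x₀ x) i * c (combine u x₀ x) k)
        + (ε * α k) * (P x * c (combine u x₀ x) i) + (ε * α i) * (P x * c (combine u x₀ x) k))
        (Measure.pi μ) := hadd.add ((hint1 k).const_mul _)
    rw [integral_congr_ae hexp, integral_add hadd' (integrable_const _),
      integral_add hadd ((hint1 k).const_mul _),
      integral_add (hint2 i k) ((hint1 i).const_mul _), integral_const_mul, integral_const_mul,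
      hmean1, hmean1, hmean2]
    simp
  have hR : ∀ i k, ∫ x, Dh u x i * Dh u x k * ∏ j ∈ u, (ProbabilityTheory.cdf (μ j) (x j) *
        (1 - ProbabilityTheory.cdf (μ j) (x j)) / (ρ j (x j)) ^ 2) ∂(Measure.pi μ)
      = (1 / 6) ^ u.card * ∫ x, c (combine u x₀ x) i * c (combine u x₀ x) k ∂(Measure.pi μ) :=
    fun i k => by
      have hae : ∀ᵐ x ∂(Measure.pi μ),
          Dh u x i * Dh u x k * ∏ j ∈ u, (ProbabilityTheory.cdf (μ j) (x j) *
            (1 - ProbabilityTheory.cdf (μ j) (x j)) / (ρ j (x j)) ^ 2)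
          = (∏ j ∈ u, (ProbabilityTheory.cdf (μ j) (x j) *
            (1 - ProbabilityTheory.cdf (μ j) (x j))))
            * (c (combine u x₀ x) i * c (combine u x₀ x) k) := by
        filter_upwards [hΩae] with x hx
        have hne : ∏ j ∈ u, ρ j (x j) ≠ 0 :=
          Finset.prod_ne_zero_iff.2 fun j _ => (hρpos j _ (hx j)).ne'
        rw [hG x hx, Finset.prod_div_distrib, Finset.prod_pow]
        simp only [Pi.smul_apply, smul_eq_mul]
        field_simp
      have hmeasF : ∀ j, Measurable fun t => ProbabilityTheory.cdf (μ j) t *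
          (1 - ProbabilityTheory.cdf (μ j) t) := fun j =>
        (ProbabilityTheory.monotone_cdf (μ j)).measurable.mul
          ((ProbabilityTheory.monotone_cdf (μ j)).measurable.const_sub 1)
      rw [integral_congr_ae hae, integral_prod_mul_comp_combine μ u hmeasF x₀
        (hccmeas i k)]
      simp_rw [integral_cdf_mul_one_sub]
      simp
  ext i k
  simp only [mVar, Matrix.of_apply, Matrix.smul_apply, smul_eq_mul]
  rw [hEE, hE, hE, hR, show (1 / 12 : ℝ) = 1 / 2 * (1 / 6) by norm_num, mul_pow, one_div_pow 2]
  ring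

end
end

section
/- For every x ∈ ℝ, ∫_ℝ (F(min(x, x')) − F(x) F(x')) dμ(x') = (1/2) F(x)(1 − F(x)). -/
open MeasureTheory

/-- For a finite measure `ν` on `ℝ` without point masses, `t ↦ ν (-∞, t]` has
`ν`-integral `ν(ℝ)² / 2`. -/
theorem integral_measureReal_Iic (ν : Measure ℝ) [IsFiniteMeasure ν] [NullSingletonClass ν] :
    ∫ t, ν.real (Set.Iic t) ∂ν = 1 / 2 * ν.real Set.univ ^ 2 := by
  have hS : MeasurableSet {p : ℝ × ℝ | p.2 ≤ p.1} :=
    measurableSet_le measurable_snd measurable_fst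
  have hswap : ∫⁻ t, ν (Set.Iic t) ∂ν = ∫⁻ t, ν (Set.Ici t) ∂ν :=
    (Measure.prod_apply (μ := ν) (ν := ν) hS).symm.trans (Measure.prod_apply_symm hS)
  have hmeas : Measurable fun t => ν (Set.Iic t) :=
    Monotone.measurable fun a b hab => measure_mono (Set.Iic_subset_Iic.2 hab)
  have hcompl (t : ℝ) : ν (Set.Iic t) + ν (Set.Ici t) = ν Set.univ := by
    rw [← measure_congr (Ioi_ae_eq_Ici (μ := ν) (a := t)), ← Set.compl_Iic,
      measure_add_measure_compl measurableSet_Iic]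
  have hsum : ∫⁻ t, ν (Set.Iic t) ∂ν + ∫⁻ t, ν (Set.Iic t) ∂ν
      = ν Set.univ * ν Set.univ := by
    nth_rw 2 [hswap]
    rw [← lintegral_add_left hmeas]
    simp only [hcompl, lintegral_const]
  have hfin : ∫⁻ t, ν (Set.Iic t) ∂ν ≠ ⊤ := fun h => by
    rw [h, top_add] at hsum
    exact ENNReal.mul_ne_top (measure_ne_top ν _) (measure_ne_top ν _) hsum.symm
  have hreal : ∫ t, ν.real (Set.Iic t) ∂ν = (∫⁻ t, ν (Set.Iic t) ∂ν).toReal :=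
    integral_toReal hmeas.aemeasurable (ae_of_all _ fun _ => measure_lt_top ν _)
  have h := congrArg ENNReal.toReal hsum
  rw [ENNReal.toReal_add hfin hfin, ENNReal.toReal_mul, ← hreal] at h
  simp only [measureReal_def] at h ⊢
  linarith

theorem integrable_measureReal_Iic_comp (μ : Measure ℝ) [IsFiniteMeasure μ] {g : ℝ → ℝ}
    (hg : Monotone g) : Integrable (fun t => μ.real (Set.Iic (g t))) μ := by
  have hmono : Monotone fun t => μ.real (Set.Iic (g t)) := fun _ _ hab =>
    measureReal_mono (Set.Iic_subset_Iic.2 (hg hab))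
  refine Integrable.of_bound hmono.measurable.aestronglyMeasurable (μ.real Set.univ)
    (ae_of_all _ fun t => ?_)
  rw [Real.norm_of_nonneg measureReal_nonneg]
  exact measureReal_mono (Set.subset_univ _)

/-- The integral of the truncated distribution function of a probability measure without
point masses. -/
theorem integral_measureReal_Iic_min (μ : Measure ℝ) [IsProbabilityMeasure μ] [NullSingletonClass μ]
    (x : ℝ) :
    ∫ t, μ.real (Set.Iic (min x t)) ∂μ
      = 1 / 2 * μ.real (Set.Iic x) ^ 2 + (1 - μ.real (Set.Iic x)) * μ.real (Set.Iic x) := by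
  have hint : Integrable (fun t => μ.real (Set.Iic (min x t))) μ :=
    integrable_measureReal_Iic_comp μ fun _ _ hab => min_le_min_left x hab
  have hrestrict (t : ℝ) :
      μ.real (Set.Iic (min x t)) = (μ.restrict (Set.Iic x)).real (Set.Iic t) := by
    rw [measureReal_restrict_apply measurableSet_Iic, Set.Iic_inter_Iic, min_comm]
  have hlow : ∫ t in Set.Iic x, μ.real (Set.Iic (min x t)) ∂μ
      = 1 / 2 * μ.real (Set.Iic x) ^ 2 := by
    simp only [hrestrict, integral_measureReal_Iic, measureReal_restrict_apply_univ]
  have hhigh : ∫ t in (Set.Iic x)ᶜ, μ.real (Set.Iic (min x t)) ∂μ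
      = (1 - μ.real (Set.Iic x)) * μ.real (Set.Iic x) := by
    rw [setIntegral_congr_fun (g := fun _ => μ.real (Set.Iic x)) measurableSet_Iic.compl
      (fun t ht => by simp only [min_eq_left (lt_of_not_ge ht : x < t).le]), setIntegral_const,
      probReal_compl_eq_one_sub measurableSet_Iic, smul_eq_mul]
  rw [← integral_add_compl measurableSet_Iic hint, hlow, hhigh]

theorem covariance_kernel_integral
    (μ : Measure ℝ) [IsProbabilityMeasure μ]
    (hac : μ ≪ volume)
    (F : ℝ → ℝ) (hFdef : ∀ t, F t = (μ (Set.Iic t)).toReal) :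
    ∀ x : ℝ, (∫ x', F (min x x') - F x * F x' ∂μ) = 1 / 2 * (F x * (1 - F x)) := by
  intro x
  have : NullSingletonClass μ := ⟨fun t => hac (measure_singleton t)⟩
  obtain rfl : F = fun t => μ.real (Set.Iic t) := funext hFdef
  have hmin : Integrable (fun t => μ.real (Set.Iic (min x t))) μ :=
    integrable_measureReal_Iic_comp μ fun _ _ hab => min_le_min_left x hab
  have hcdf : Integrable (fun t => μ.real (Set.Iic t)) μ :=
    integrable_measureReal_Iic_comp μ monotone_id
  beta_reduce
  rw [integral_sub hmin (hcdf.const_mul _), integral_const_mul,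
    integral_measureReal_Iic_min, integral_measureReal_Iic, probReal_univ]
  ring
end
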